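/- Let n ≥ 1, let g : ℝⁿ → ℝ be bounded, of class C², and compactly supported, and let f : (0,∞) × ℝⁿ → ℝ be bounded, of class C², and compactly supported. Then for every t > 0, x ∈ ℝⁿ, the integrals v(t,x) = ∫₀^t ∫_{ℝⁿ} W(τ,y) f(t−τ, x−y) dy dτ + ∫_{ℝⁿ} W(t, x−y) g(y) dy are well defined, v is a classical solution of the Cauchy problem ∂_t v = Δv + f for t > 0 with v(0,·) = g, and moreover for all i,j ∈ {1,…,n}: ∂_{x_i x_j} v(t,x) = lim_{ε→0} ∫_ε^t ∫_{ℝⁿ} ∂_{y_i y_j} W(τ, x−y) f(t−τ, y) dy dτ + ∫_{ℝⁿ} ∂_{y_i y_j} W(t,y) g(x−y) dy and ∂_t v(t,x) = lim_{ε→0} ∫_ε^t ∫_{ℝⁿ} ∂_τ W(τ, x−y) f(t−τ, y) dy dτ + ∫_{ℝⁿ} ∂_t W(t,y) g(x−y) dy + f(t,x). -/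

import Mathlib

open MeasureTheory Filter Set Metric
open scoped ENNReal NNReal Topology

noncomputable section

abbrev En (n : ℕ) := EuclideanSpace ℝ (Fin n)

/-- The Gauss–Weierstrass kernel `W(τ,y) = (4πτ)^{-n/2} exp(-|y|²/(4τ))`, extended by `0`
for `τ ≤ 0`. -/
def W (n : ℕ) (τ : ℝ) (y : En n) : ℝ :=
  if 0 < τ then (4 * Real.pi * τ) ^ (-(n : ℝ) / 2) * Real.exp (-‖y‖ ^ 2 / (4 * τ)) else 0

/-- Partial derivative of `g : ℝⁿ → ℝ` in the `i`-th coordinate direction. -/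
def pd {n : ℕ} (i : Fin n) (g : En n → ℝ) (y : En n) : ℝ :=
  fderiv ℝ g y (EuclideanSpace.single i 1)

/-- Laplacian of `g : ℝⁿ → ℝ`. -/
def lap {n : ℕ} (g : En n → ℝ) (x : En n) : ℝ :=
  ∑ i : Fin n, pd i (pd i g) x

/-- `∂_{y_i y_j} W(τ, ·)`. -/
def Wij (n : ℕ) (i j : Fin n) (τ : ℝ) (y : En n) : ℝ :=
  pd i (pd j (W n τ)) y

/-- `∂_τ W(·, y)`. -/
def Wt (n : ℕ) (τ : ℝ) (y : En n) : ℝ :=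
  deriv (fun σ => W n σ y) τ

/-- The truncation region `Ω_ε = {(τ,y) : max(|τ|^{1/2}, |y|) > ε}`. -/
def Omega (n : ℕ) (ε : ℝ) : Set (ℝ × En n) :=
  {p | ε < max (Real.sqrt |p.1|) ‖p.2‖}

/-- `A_n = (1/(n Γ(n/2))) ∫_{1/4}^∞ u^{n/2-1} e^{-u} du`. -/
def An (n : ℕ) : ℝ :=
  (1 / (n * Real.Gamma ((n : ℝ) / 2))) *
    ∫ u in Set.Ioi (1 / 4 : ℝ), u ^ ((n : ℝ) / 2 - 1) * Real.exp (-u)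

/-- `B_n = (1/Γ(n/2)) ∫_0^{1/4} u^{n/2-1} e^{-u} du`. -/
def Bn (n : ℕ) : ℝ :=
  (1 / Real.Gamma ((n : ℝ) / 2)) *
    ∫ u in Set.Ioo (0 : ℝ) (1 / 4 : ℝ), u ^ ((n : ℝ) / 2 - 1) * Real.exp (-u)

/-- The candidate solution of the Cauchy problem:
`v(t,x) = ∫₀^t ∫_{ℝⁿ} W(τ,y) f(t-τ, x-y) dy dτ + ∫_{ℝⁿ} W(t, x-y) g(y) dy`. -/
def vSol (n : ℕ) (f : ℝ × En n → ℝ) (g : En n → ℝ) (t : ℝ) (x : En n) : ℝ :=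
  (∫ τ in Set.Ioo (0 : ℝ) t, ∫ y : En n, W n τ y * f (t - τ, x - y)) +
    ∫ y : En n, W n t (x - y) * g y

lemma W_eq {n : ℕ} {τ : ℝ} (hτ : 0 < τ) (y : En n) :
    W n τ y = (4 * Real.pi * τ) ^ (-(n : ℝ) / 2) * Real.exp (-‖y‖ ^ 2 / (4 * τ)) := if_pos hτ

lemma W_nonneg (n : ℕ) (τ : ℝ) (y : En n) : 0 ≤ W n τ y := by
  unfold W
  split_ifs with h
  · positivity
  · exact le_rfl

lemma measurable_W (n : ℕ) : Measurable fun p : ℝ × En n => W n p.1 p.2 := by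
  unfold W
  refine Measurable.ite (measurableSet_lt measurable_const measurable_fst) ?_ measurable_const
  fun_prop

lemma contDiffOn_W (n : ℕ) :
    ContDiffOn ℝ 2 (fun p : ℝ × En n => W n p.1 p.2) (Ioi 0 ×ˢ univ) := by
  have h : ContDiffOn ℝ 2 (fun p : ℝ × En n => (4 * Real.pi * p.1) ^ (-(n : ℝ) / 2) *
      Real.exp (-‖p.2‖ ^ 2 / (4 * p.1))) (Ioi 0 ×ˢ univ) := by
    intro p hp
    have hp1 : 0 < p.1 := hp.1
    refine ContDiffAt.contDiffWithinAt ?_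
    refine ContDiffAt.mul ?_ ?_
    · refine ContDiffAt.rpow_const_of_ne (by fun_prop) (by positivity)
    · refine ContDiffAt.exp ?_
      refine ContDiffAt.div ?_ (by fun_prop) (by positivity)
      exact ((contDiff_snd.norm_sq ℝ).neg).contDiffAt
  exact h.congr fun p hp => W_eq hp.1 p.2

lemma integral_W {n : ℕ} {τ : ℝ} (hτ : 0 < τ) : ∫ y : En n, W n τ y = 1 := by
  have h := GaussianFourier.integral_rexp_neg_mul_sq_norm (V := En n) (b := 1 / (4 * τ))
    (by positivity)
  simp_rw [W_eq hτ]
  rw [integral_const_mul]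
  have e : ∀ y : En n, -‖y‖ ^ 2 / (4 * τ) = -(1 / (4 * τ)) * ‖y‖ ^ 2 := fun y => by ring
  simp_rw [e, h]
  have e2 : Real.pi / (1 / (4 * τ)) = 4 * Real.pi * τ := by field_simp
  rw [e2, finrank_euclideanSpace_fin, ← Real.rpow_add (by positivity)]
  ring_nf
  simp

lemma integrable_W {n : ℕ} {τ : ℝ} (hτ : 0 < τ) : Integrable (W n τ) :=
  integrable_of_integral_eq_one (integral_W hτ)

/-- Parabolic scaling. -/
lemma W_sqrt_smul {n : ℕ} {τ : ℝ} (hτ : 0 < τ) (z : En n) :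
    W n τ (√τ • z) = (√τ ^ n)⁻¹ * W n 1 z := by
  rw [W_eq hτ, W_eq one_pos, Real.mul_rpow (by positivity) hτ.le, norm_smul, mul_pow]
  have : τ ^ (-(n : ℝ) / 2) = (√τ ^ n)⁻¹ := by
    rw [Real.sqrt_eq_rpow, ← Real.rpow_natCast, ← Real.rpow_mul hτ.le, ← Real.rpow_neg hτ.le]
    ring_nf
  rw [this]
  have e : -(‖√τ‖ ^ 2 * ‖z‖ ^ 2) / (4 * τ) = -‖z‖ ^ 2 / (4 * 1) := by
    rw [Real.norm_eq_abs, sq_abs, Real.sq_sqrt hτ.le]; field_simp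
  rw [e]; simp only [mul_one]; ring

lemma integral_W_mul_eq_scaled {n : ℕ} {τ : ℝ} (hτ : 0 < τ) (h : En n → ℝ) :
    ∫ y : En n, W n τ y * h y = ∫ z : En n, W n 1 z * h (√τ • z) := by
  have hs : 0 < √τ := Real.sqrt_pos.2 hτ
  have := Measure.integral_comp_smul (volume : Measure (En n)) (fun y => W n τ y * h y) √τ
  simp only [W_sqrt_smul hτ, finrank_euclideanSpace_fin, smul_eq_mul, mul_assoc,
    integral_const_mul] at this
  rw [abs_of_pos (by positivity)] at this
  exact (mul_left_cancel₀ (by positivity) this).symm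

lemma integrable_W_prod (n : ℕ) (t : ℝ) :
    IntegrableOn (fun p : ℝ × En n => W n p.1 p.2) (Ioo 0 t ×ˢ univ) := by
  rw [IntegrableOn, Measure.volume_eq_prod, ← Measure.prod_restrict, Measure.restrict_univ,
    integrable_prod_iff (measurable_W n).aestronglyMeasurable]
  refine ⟨?_, ?_⟩
  · filter_upwards [ae_restrict_mem measurableSet_Ioo] with τ hτ using integrable_W hτ.1
  · have : IntegrableOn (fun _ : ℝ => (1 : ℝ)) (Ioo 0 t) := by simp
    refine Integrable.congr this ?_
    filter_upwards [ae_restrict_mem measurableSet_Ioo] with τ hτ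
    simp_rw [Real.norm_of_nonneg (W_nonneg _ _ _)]
    exact (integral_W hτ.1).symm

lemma hasFDerivAt_W {n : ℕ} {τ : ℝ} (hτ : 0 < τ) (y : En n) :
    HasFDerivAt (W n τ) ((-(W n τ y / (2 * τ))) • innerSL ℝ y) y := by
  have h : HasFDerivAt (fun y : En n => (4 * Real.pi * τ) ^ (-(n : ℝ) / 2) *
      Real.exp (-‖y‖ ^ 2 / (4 * τ))) ((-(W n τ y / (2 * τ))) • innerSL ℝ y) y := by
    have h1 := ((((hasStrictFDerivAt_norm_sq y).hasFDerivAt.neg).mul_const (4 * τ)⁻¹).exp).const_mul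
      ((4 * Real.pi * τ) ^ (-(n : ℝ) / 2))
    refine h1.congr_fderiv ?_
    ext v
    simp [W_eq hτ]
    field_simp
    ring
  exact h.congr_of_eventuallyEq (Eventually.of_forall fun y => W_eq hτ y)

lemma pd_W {n : ℕ} {τ : ℝ} (hτ : 0 < τ) (i : Fin n) :
    pd i (W n τ) = fun y => -(1 / (2 * τ)) * (W n τ y * y i) := by
  ext y
  simp [pd, (hasFDerivAt_W hτ y).fderiv, EuclideanSpace.inner_single_right]
  ring

lemma Wij_self {n : ℕ} {τ : ℝ} (hτ : 0 < τ) (i : Fin n) (y : En n) :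
    Wij n i i τ y = W n τ y * (y i ^ 2 / (4 * τ ^ 2) - 1 / (2 * τ)) := by
  have h := (((hasFDerivAt_W hτ y).mul (EuclideanSpace.proj (𝕜 := ℝ) i).hasFDerivAt).const_mul
    (-(1 / (2 * τ)))).fderiv
  rw [Wij, pd_W hτ, pd]
  erw [h]
  simp [EuclideanSpace.inner_single_right]
  field_simp
  ring

lemma hasDerivAt_W {n : ℕ} {τ : ℝ} (hτ : 0 < τ) (y : En n) :
    HasDerivAt (fun σ => W n σ y)
      (W n τ y * (‖y‖ ^ 2 / (4 * τ ^ 2) - n / (2 * τ))) τ := by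
  have h : HasDerivAt (fun σ => (4 * Real.pi * σ) ^ (-(n : ℝ) / 2) *
      Real.exp (-‖y‖ ^ 2 / (4 * σ)))
      (W n τ y * (‖y‖ ^ 2 / (4 * τ ^ 2) - n / (2 * τ))) τ := by
    have h1 : HasDerivAt (fun σ : ℝ => 4 * Real.pi * σ) (4 * Real.pi) τ := by
      simpa using (hasDerivAt_id τ).const_mul (4 * Real.pi)
    have h2 := h1.rpow_const (p := -(n : ℝ) / 2) (Or.inl (by positivity))
    have h3 : HasDerivAt (fun σ : ℝ => 4 * σ) 4 τ := by
      simpa using (hasDerivAt_id τ).const_mul (4 : ℝ)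
    have h4 := ((hasDerivAt_const τ (-‖y‖ ^ 2)).div h3 (by positivity)).exp
    refine (h2.mul h4).congr_deriv ?_
    rw [W_eq hτ, Real.rpow_sub_one (by positivity), Pi.div_apply]
    field_simp
    ring
  refine h.congr_of_eventuallyEq ?_
  filter_upwards [lt_mem_nhds hτ] with σ hσ using W_eq hσ y

lemma Wt_eq_sum_Wij {n : ℕ} {τ : ℝ} (hτ : 0 < τ) (y : En n) :
    Wt n τ y = ∑ i, Wij n i i τ y := by
  rw [Wt, (hasDerivAt_W hτ y).deriv]
  simp_rw [Wij_self hτ, ← Finset.mul_sum, Finset.sum_sub_distrib, ← Finset.sum_div]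
  rw [EuclideanSpace.norm_sq_eq]
  simp

lemma exists_abs_le_of_hasCompactSupport {G : Type*} [TopologicalSpace G] {h : G → ℝ}
    (hh : Continuous h) (hc : HasCompactSupport h) : ∃ M, ∀ z, |h z| ≤ M :=
  hh.bounded_above_of_compact_support hc

/-- Differentiation under the integral sign for superpositions of translates. -/
lemma hasFDerivAt_integral_translate {α G : Type*} [MeasurableSpace α] [NormedAddCommGroup G]
    [NormedSpace ℝ G] {μ : Measure α} {k : α → ℝ} (hk : Integrable k μ) {φ : α → G}
    (hφ : AEStronglyMeasurable φ μ) {h : G → ℝ} (hh : ContDiff ℝ 1 h)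
    (hc : HasCompactSupport h) (z : G) :
    HasFDerivAt (fun z => ∫ a, k a * h (z - φ a) ∂μ)
      (∫ a, k a • fderiv ℝ h (z - φ a) ∂μ) z ∧
    Integrable (fun a => k a • fderiv ℝ h (z - φ a)) μ := by
  obtain ⟨M, hM⟩ := exists_abs_le_of_hasCompactSupport hh.continuous hc
  have hf' : Continuous (fderiv ℝ h) := hh.continuous_fderiv one_ne_zero
  obtain ⟨C, hC⟩ := hf'.bounded_above_of_compact_support (hc.fderiv ℝ)
  have hsub : ∀ z, AEStronglyMeasurable (fun a => z - φ a) μ := fun z =>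
    aestronglyMeasurable_const.sub hφ
  have hm' : AEStronglyMeasurable (fun a => k a • fderiv ℝ h (z - φ a)) μ :=
    hk.aestronglyMeasurable.smul (hf'.comp_aestronglyMeasurable (hsub z))
  have hb : ∀ a z, ‖k a • fderiv ℝ h (z - φ a)‖ ≤ ‖k a‖ * C := fun a z => by
    rw [norm_smul]
    exact mul_le_mul_of_nonneg_left (hC _) (norm_nonneg _)
  refine ⟨hasFDerivAt_integral_of_dominated_of_fderiv_le (bound := fun a => ‖k a‖ * C)
    (F := fun z a => k a * h (z - φ a))
    (F' := fun z a => k a • fderiv ℝ h (z - φ a)) (s := univ) univ_mem ?_ ?_ hm' ?_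
    (hk.norm.mul_const C) ?_, ?_⟩
  · exact Eventually.of_forall fun z =>
      hk.aestronglyMeasurable.mul (hh.continuous.comp_aestronglyMeasurable (hsub z))
  · exact hk.mul_bdd (c := M) (hh.continuous.comp_aestronglyMeasurable (hsub z))
      (Eventually.of_forall fun a => hM _)
  · exact Eventually.of_forall fun a z _ => hb a z
  · refine Eventually.of_forall fun a z _ => ?_
    have h1 := (hh.differentiable one_ne_zero (z - φ a)).hasFDerivAt
    have h2 : HasFDerivAt (fun z => z - φ a) (ContinuousLinearMap.id ℝ G) z :=
      (hasFDerivAt_id z).sub_const _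
    simpa using (h1.comp z h2).const_mul (k a)
  · exact (hk.norm.mul_const C).mono' hm' (Eventually.of_forall fun a => hb a z)

/-- Derivative of `h` in the direction `v`. -/
abbrev dd {G : Type*} [NormedAddCommGroup G] [NormedSpace ℝ G] (v : G) (h : G → ℝ) (z : G) : ℝ :=
  fderiv ℝ h z v

lemma hasCompactSupport_dd {G : Type*} [NormedAddCommGroup G] [NormedSpace ℝ G] {h : G → ℝ}
    (hc : HasCompactSupport h) (v : G) : HasCompactSupport (dd v h) :=
  hc.fderiv_apply ℝ v

lemma contDiff_dd {G : Type*} [NormedAddCommGroup G] [NormedSpace ℝ G] {h : G → ℝ}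
    {m k : ℕ} (hh : ContDiff ℝ k h) (hmk : m + 1 ≤ k) (v : G) : ContDiff ℝ m (dd v h) :=
  (hh.fderiv_right (m := m) (by exact_mod_cast hmk)).clm_apply contDiff_const

lemma hasFDerivAt_integral_translate_apply {α G : Type*} [MeasurableSpace α]
    [NormedAddCommGroup G] [NormedSpace ℝ G] {μ : Measure α} {k : α → ℝ} (hk : Integrable k μ)
    {φ : α → G} (hφ : AEStronglyMeasurable φ μ) {h : G → ℝ} (hh : ContDiff ℝ 1 h)
    (hc : HasCompactSupport h) (z : G) :
    ∃ L : G →L[ℝ] ℝ, HasFDerivAt (fun z => ∫ a, k a * h (z - φ a) ∂μ) L z ∧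
      ∀ v, L v = ∫ a, k a * dd v h (z - φ a) ∂μ := by
  obtain ⟨h1, h2⟩ := hasFDerivAt_integral_translate hk hφ hh hc z
  refine ⟨_, h1, fun v => ?_⟩
  rw [ContinuousLinearMap.integral_apply h2]
  rfl

/-- A heat average of `f` over the time slice `s - τ`, in parabolically scaled variables. -/
def heatAvg (n : ℕ) (f : ℝ × En n → ℝ) (x : En n) (s τ : ℝ) : ℝ :=
  ∫ z : En n, W n 1 z * f (s - τ, x - √τ • z)

lemma integral_W_mul_eq_heatAvg {n : ℕ} (f : ℝ × En n → ℝ) (x : En n) (s : ℝ) {τ : ℝ}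
    (hτ : 0 < τ) : ∫ y : En n, W n τ y * f (s - τ, x - y) = heatAvg n f x s τ :=
  integral_W_mul_eq_scaled hτ (fun y => f (s - τ, x - y))

lemma heatAvg_zero {n : ℕ} (f : ℝ × En n → ℝ) (x : En n) (s : ℝ) :
    heatAvg n f x s 0 = f (s, x) := by
  simp [heatAvg, integral_mul_const, integral_W one_pos]

lemma continuous_heatAvg {n : ℕ} {f : ℝ × En n → ℝ} (hf : Continuous f) {M : ℝ}
    (hM : ∀ z, |f z| ≤ M) (x : En n) : Continuous fun p : ℝ × ℝ => heatAvg n f x p.1 p.2 := by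
  unfold heatAvg
  have hm : Measurable (W n 1) := (measurable_W n).comp measurable_prodMk_left
  refine continuous_of_dominated (bound := fun z => W n 1 z * M) (fun p => ?_) (fun p => ?_)
    ((integrable_W one_pos).mul_const M) ?_
  · exact hm.aestronglyMeasurable.mul (Continuous.aestronglyMeasurable (by fun_prop))
  · refine Eventually.of_forall fun z => ?_
    rw [norm_mul, Real.norm_of_nonneg (W_nonneg _ _ _)]
    exact mul_le_mul_of_nonneg_left (hM _) (W_nonneg _ _ _)
  · exact Eventually.of_forall fun z => by fun_prop

lemma abs_heatAvg_le {n : ℕ} {f : ℝ × En n → ℝ} {M : ℝ} (hM : ∀ z, |f z| ≤ M) (x : En n)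
    (s τ : ℝ) : |heatAvg n f x s τ| ≤ M := by
  have := norm_integral_le_of_norm_le ((integrable_W (n := n) one_pos).mul_const M)
    (f := fun z => W n 1 z * f (s - τ, x - √τ • z)) (Eventually.of_forall fun z => by
      rw [norm_mul, Real.norm_of_nonneg (W_nonneg _ _ _)]
      exact mul_le_mul_of_nonneg_left (hM _) (W_nonneg _ _ _))
  rwa [integral_mul_const, integral_W one_pos, one_mul] at this

lemma hasDerivAt_intervalIntegral_diag {ψ : ℝ × ℝ → ℝ} (hψ : Continuous ψ) (t : ℝ) :
    HasDerivAt (fun s => ∫ τ in t..s, ψ (s, τ)) (ψ (t, t)) t := by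
  rw [hasDerivAt_iff_isLittleO, Asymptotics.isLittleO_iff]
  intro c hc
  obtain ⟨δ, hδ, h⟩ := Metric.continuousAt_iff.1 (hψ.continuousAt (x := (t, t))) c hc
  filter_upwards [Metric.ball_mem_nhds t hδ] with s hs
  have e : (∫ τ in t..s, ψ (s, τ)) - (∫ τ in t..t, ψ (t, τ)) - (s - t) • ψ (t, t)
      = ∫ τ in t..s, (ψ (s, τ) - ψ (t, t)) := by
    rw [intervalIntegral.integral_sub
      (Continuous.intervalIntegrable (by fun_prop) _ _) (by simp)]
    simp
  rw [e, Real.norm_eq_abs (s - t)]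
  refine intervalIntegral.norm_integral_le_of_norm_le_const fun τ hτ => ?_
  rw [← dist_eq_norm]
  refine (h ?_).le
  rw [Prod.dist_eq, max_lt_iff]
  refine ⟨hs, ?_⟩
  refine lt_of_le_of_lt ?_ hs
  simp only [Real.dist_eq]
  exact Set.abs_sub_left_of_mem_uIcc (uIoc_subset_uIcc hτ)

lemma integral_Ioo_eq_heatAvg {n : ℕ} (f : ℝ × En n → ℝ) (x : En n) (s : ℝ) {a b : ℝ}
    (ha : 0 ≤ a) (hab : a ≤ b) :
    ∫ τ in Ioo a b, ∫ y : En n, W n τ y * f (s - τ, x - y) = ∫ τ in a..b, heatAvg n f x s τ := by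
  rw [intervalIntegral.integral_of_le hab, integral_Ioc_eq_integral_Ioo]
  exact setIntegral_congr_fun measurableSet_Ioo fun τ hτ =>
    integral_W_mul_eq_heatAvg f x s (ha.trans_lt hτ.1)

lemma integrableOn_W_mul {n : ℕ} {f : ℝ × En n → ℝ} (hf : Continuous f) {M : ℝ}
    (hM : ∀ z, |f z| ≤ M) (t s : ℝ) (x : En n) :
    IntegrableOn (fun p : ℝ × En n => W n p.1 p.2 * f (s - p.1, x - p.2)) (Ioo 0 t ×ˢ univ) :=
  (integrable_W_prod n t).mul_bdd (c := M)
    (Continuous.aestronglyMeasurable (by fun_prop)) (Eventually.of_forall fun _ => hM _)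

lemma integral_prod_eq_heatAvg {n : ℕ} {f : ℝ × En n → ℝ} (hf : Continuous f) {M : ℝ}
    (hM : ∀ z, |f z| ≤ M) {t : ℝ} (ht : 0 ≤ t) (s : ℝ) (x : En n) :
    ∫ p in Ioo 0 t ×ˢ univ, W n p.1 p.2 * f ((s, x) - p) = ∫ τ in 0..t, heatAvg n f x s τ := by
  rw [← integral_Ioo_eq_heatAvg f x s le_rfl ht, Measure.volume_eq_prod, setIntegral_prod]
  · simp
  · exact integrableOn_W_mul hf hM t s x

lemma vSol_eq {n : ℕ} (f : ℝ × En n → ℝ) (g : En n → ℝ) {t : ℝ} (ht : 0 ≤ t) (x : En n) :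
    vSol n f g t x = (∫ τ in 0..t, heatAvg n f x t τ) + ∫ y, W n t y * g (x - y) := by
  rw [vSol, integral_Ioo_eq_heatAvg f x t le_rfl ht,
    ← integral_sub_left_eq_self (fun y => W n t y * g (x - y)) volume x]
  simp

/-- Space derivatives of the Duhamel solution fall on the data. -/
lemma pd_vSol {n : ℕ} {f : ℝ × En n → ℝ} {g : En n → ℝ} (hf : ContDiff ℝ 1 f)
    (hfc : HasCompactSupport f) (hg : ContDiff ℝ 1 g) (hgc : HasCompactSupport g) {t : ℝ}
    (ht : 0 < t) (i : Fin n) :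
    pd i (vSol n f g t) = vSol n (dd (0, EuclideanSpace.single i 1) f) (pd i g) t := by
  ext x
  obtain ⟨M, hM⟩ := exists_abs_le_of_hasCompactSupport hf.continuous hfc
  obtain ⟨M', hM'⟩ := exists_abs_le_of_hasCompactSupport
    (contDiff_dd (m := 0) (k := 1) hf le_rfl (0, EuclideanSpace.single i 1)).continuous
    (hasCompactSupport_dd hfc (0, EuclideanSpace.single i 1))
  obtain ⟨L, hL, hL'⟩ := hasFDerivAt_integral_translate_apply (integrable_W_prod n t)
    (φ := fun p => p) aestronglyMeasurable_id hf hfc (t, x)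
  obtain ⟨N, hN, hN'⟩ := hasFDerivAt_integral_translate_apply (integrable_W (n := n) ht)
    (φ := fun p => p) aestronglyMeasurable_id hg hgc x
  have e : vSol n f g t = fun x => (∫ p in Ioo 0 t ×ˢ univ, W n p.1 p.2 * f ((t, x) - p)) +
      ∫ y, W n t y * g (x - y) := by
    ext x
    rw [vSol_eq f g ht.le, integral_prod_eq_heatAvg hf.continuous hM ht.le]
  have h1 : HasFDerivAt (fun x : En n => (t, x)) (ContinuousLinearMap.inr ℝ ℝ (En n)) x :=
    hasFDerivAt_prodMk_right t x
  have h2 := (hL.comp x h1).add hN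
  rw [e, vSol_eq _ _ ht.le, ← integral_prod_eq_heatAvg
    (contDiff_dd (m := 0) (k := 1) hf le_rfl _).continuous hM' ht.le, pd]
  erw [h2.fderiv]
  simp [hL', hN', pd]

lemma contDiff_W {n : ℕ} {τ : ℝ} (hτ : 0 < τ) : ContDiff ℝ 2 (W n τ) := by
  rw [← contDiffOn_univ]
  exact (contDiffOn_W n).comp (contDiff_prodMk_right τ).contDiffOn fun y _ =>
    mk_mem_prod (mem_Ioi.2 hτ) (mem_univ y)

lemma integral_pd_mul {n : ℕ} {A h : En n → ℝ} (hA : ContDiff ℝ 1 A) (hh : ContDiff ℝ 1 h)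
    (hc : HasCompactSupport h) (x : En n) (i : Fin n) :
    ∫ y, pd i A y * h (x - y) = ∫ y, A y * pd i h (x - y) := by
  have hd : ∀ y, HasFDerivAt (fun y => h (x - y))
      ((fderiv ℝ h (x - y)).comp (-(ContinuousLinearMap.id ℝ (En n)))) y := fun y =>
    (hh.differentiable one_ne_zero (x - y)).hasFDerivAt.comp y ((hasFDerivAt_id y).const_sub x)
  have hc' : HasCompactSupport fun y => h (x - y) := hc.comp_homeomorph (Homeomorph.subLeft x)
  have hpc : HasCompactSupport fun y => pd i h (x - y) :=
    (hasCompactSupport_dd hc _).comp_homeomorph (Homeomorph.subLeft x)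
  have hpi : Continuous (pd i h) := (contDiff_dd (m := 0) (k := 1) hh le_rfl _).continuous
  have hpA : Continuous (pd i A) := (contDiff_dd (m := 0) (k := 1) hA le_rfl _).continuous
  have hAc := hA.continuous
  have hhc := hh.continuous
  have e : ∀ y, fderiv ℝ (fun y => h (x - y)) y (EuclideanSpace.single i 1) =
      -pd i h (x - y) := fun y => by
    rw [(hd y).fderiv]
    simp [pd]
  have key := integral_mul_fderiv_eq_neg_fderiv_mul_of_integrable (μ := volume) (f := A)
    (g := fun y => h (x - y)) (v := EuclideanSpace.single i (1 : ℝ))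
    (Continuous.integrable_of_hasCompactSupport
      (by change Continuous fun y => pd i A y * h (x - y); fun_prop) hc'.mul_left)
    (by
      simp_rw [e]
      exact Continuous.integrable_of_hasCompactSupport (by fun_prop) hpc.neg.mul_left)
    (Continuous.integrable_of_hasCompactSupport (by fun_prop) hc'.mul_left)
    (fun y _ => hA.differentiable one_ne_zero y)
    (fun y _ => (hd y).differentiableAt)
  simp_rw [e, mul_neg, integral_neg, neg_inj] at key
  exact key.symm

lemma pd_comm {n : ℕ} {h : En n → ℝ} (hh : ContDiff ℝ 2 h) (i j : Fin n) (y : En n) :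
    pd i (pd j h) y = pd j (pd i h) y := by
  have hs := (hh.contDiffAt (x := y)).isSymmSndFDerivAt (by simp)
  have hd : DifferentiableAt ℝ (fderiv ℝ h) y :=
    (hh.fderiv_right (m := 1) (by norm_num)).differentiable one_ne_zero y
  have e : ∀ i j : Fin n, pd i (pd j h) y = fderiv ℝ (fderiv ℝ h) y
      (EuclideanSpace.single i 1) (EuclideanSpace.single j 1) := fun i j => by
    unfold pd
    rw [fderiv_clm_apply hd (by fun_prop)]
    simp
  rw [e, e, hs.eq]

lemma contDiff_pd {n : ℕ} {h : En n → ℝ} (hh : ContDiff ℝ 2 h) (i : Fin n) :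
    ContDiff ℝ 1 (pd i h) := contDiff_dd (m := 1) (k := 2) hh le_rfl _

lemma hasCompactSupport_pd {n : ℕ} {h : En n → ℝ} (hc : HasCompactSupport h) (i : Fin n) :
    HasCompactSupport (pd i h) := hasCompactSupport_dd hc _

lemma integral_Wij_mul {n : ℕ} {τ : ℝ} (hτ : 0 < τ) {h : En n → ℝ} (hh : ContDiff ℝ 2 h)
    (hc : HasCompactSupport h) (x : En n) (i j : Fin n) :
    ∫ y, Wij n i j τ y * h (x - y) = ∫ y, W n τ y * pd i (pd j h) (x - y) := by
  unfold Wij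
  rw [integral_pd_mul (contDiff_pd (contDiff_W hτ) j) (hh.of_le one_le_two) hc,
    integral_pd_mul ((contDiff_W hτ).of_le one_le_two) (contDiff_pd hh i)
      (hasCompactSupport_pd hc i)]
  simp_rw [pd_comm hh i j]

lemma integral_Wt_mul {n : ℕ} {τ : ℝ} (hτ : 0 < τ) {h : En n → ℝ} (hh : ContDiff ℝ 2 h)
    (hc : HasCompactSupport h) (x : En n) :
    ∫ y, Wt n τ y * h (x - y) = ∫ y, W n τ y * lap h (x - y) := by
  simp_rw [Wt_eq_sum_Wij hτ, lap, Finset.sum_mul, Finset.mul_sum]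
  rw [integral_finsetSum, integral_finsetSum]
  · exact Finset.sum_congr rfl fun i _ => integral_Wij_mul hτ hh hc x i i
  · intro i _
    refine Continuous.integrable_of_hasCompactSupport (.mul (contDiff_W hτ).continuous ?_) ?_
    · have := (contDiff_dd (m := 0) (k := 1) (contDiff_pd hh i) le_rfl
        (EuclideanSpace.single i 1)).continuous
      exact this.comp (by fun_prop)
    · exact ((hasCompactSupport_pd (hasCompactSupport_pd hc i) i).comp_homeomorph
        (Homeomorph.subLeft x)).mul_left
  · intro i _
    refine Continuous.integrable_of_hasCompactSupport (.mul ?_ ?_) ?_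
    · exact (contDiff_dd (m := 0) (k := 1) (contDiff_pd (contDiff_W hτ) i) le_rfl
        (EuclideanSpace.single i 1)).continuous
    · exact hh.continuous.comp (by fun_prop)
    · exact (hc.comp_homeomorph (Homeomorph.subLeft x)).mul_left

lemma hasDerivAt_integral_of_contDiffOn {n : ℕ} {q : ℝ × En n → ℝ}
    (hq : ContDiffOn ℝ 1 q (Ioi 0 ×ˢ univ)) {K : Set (En n)} (hK : IsCompact K)
    (hqK : ∀ σ y, y ∉ K → q (σ, y) = 0) {τ : ℝ} (hτ : 0 < τ) :
    HasDerivAt (fun σ => ∫ y, q (σ, y)) (∫ y, fderiv ℝ q (τ, y) (1, 0)) τ := by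
  have ho : IsOpen (Ioi (0 : ℝ) ×ˢ (univ : Set (En n))) := isOpen_Ioi.prod isOpen_univ
  have hd : ∀ σ y, 0 < σ → HasDerivAt (fun σ => q (σ, y)) (fderiv ℝ q (σ, y) (1, 0)) σ := by
    intro σ y hσ
    have h1 : HasFDerivAt q (fderiv ℝ q (σ, y)) (σ, y) :=
      ((hq.differentiableOn one_ne_zero).differentiableAt
        (ho.mem_nhds (mk_mem_prod (mem_Ioi.2 hσ) (mem_univ y)))).hasFDerivAt
    exact h1.comp_hasDerivAt σ ((hasDerivAt_id σ).prodMk (hasDerivAt_const σ y))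
  have hc' : ContinuousOn (fderiv ℝ q) (Ioi 0 ×ˢ univ) :=
    hq.continuousOn_fderiv_of_isOpen ho le_rfl
  have hslice : ∀ {σ : ℝ}, 0 < σ → ∀ {β : Type} [TopologicalSpace β] {r : ℝ × En n → β},
      ContinuousOn r (Ioi 0 ×ˢ univ) → Continuous fun y => r (σ, y) := fun hσ _ _ r hr =>
    hr.comp_continuous (by fun_prop) fun y => mk_mem_prod (mem_Ioi.2 hσ) (mem_univ y)
  have hsub : Icc (τ / 2) (2 * τ) ×ˢ K ⊆ Ioi 0 ×ˢ univ :=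
    Set.prod_mono (fun σ hσ => (half_pos hτ).trans_le hσ.1) (subset_univ K)
  obtain ⟨C, hC⟩ := (isCompact_Icc.prod hK).exists_bound_of_continuousOn (hc'.mono hsub)
  have hs : Icc (τ / 2) (2 * τ) ∈ 𝓝 τ := Icc_mem_nhds (by linarith) (by linarith)
  refine (hasDerivAt_integral_of_dominated_loc_of_deriv_le (s := Icc (τ / 2) (2 * τ))
    (F := fun σ y => q (σ, y)) (F' := fun σ y => fderiv ℝ q (σ, y) (1, 0))
    (bound := K.indicator fun _ => C * ‖((1 : ℝ), (0 : En n))‖) hs ?_ ?_ ?_ ?_ ?_ ?_).2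
  · filter_upwards [lt_mem_nhds hτ] with σ hσ
    exact (hslice hσ hq.continuousOn).aestronglyMeasurable
  · exact (hslice hτ hq.continuousOn).integrable_of_hasCompactSupport
      (HasCompactSupport.intro hK fun y hy => hqK τ y hy)
  · exact (hslice hτ (hc'.clm_apply continuousOn_const)).aestronglyMeasurable
  · refine Eventually.of_forall fun y σ hσ => ?_
    by_cases hy : y ∈ K
    · rw [indicator_of_mem hy]
      exact ((fderiv ℝ q (σ, y)).le_opNorm _).trans
        (mul_le_mul_of_nonneg_right (hC (σ, y) ⟨hσ, hy⟩) (norm_nonneg _))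
    · rw [indicator_of_notMem hy, (hd σ y ((half_pos hτ).trans_le hσ.1)).unique
        ((hasDerivAt_const σ (0 : ℝ)).congr_of_eventuallyEq
          (Eventually.of_forall fun s => hqK s y hy)), norm_zero]
  · exact (integrable_indicator_iff hK.measurableSet).2 (integrableOn_const hK.measure_ne_top)
  · exact Eventually.of_forall fun y σ hσ => hd σ y ((half_pos hτ).trans_le hσ.1)

/-- Time derivative of the heat average of a function that itself depends on time. -/
lemma hasDerivAt_integral_W_mul {n : ℕ} {F : ℝ × En n → ℝ} (hF : ContDiff ℝ 2 F)
    {K : Set (En n)} (hK : IsCompact K) (hFK : ∀ σ y, y ∉ K → F (σ, y) = 0) (x : En n) {τ : ℝ}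
    (hτ : 0 < τ) :
    HasDerivAt (fun σ => ∫ y, W n σ y * F (σ, x - y))
      (∫ y, W n τ y * (lap (fun y => F (τ, y)) (x - y) + dd (1, 0) F (τ, x - y))) τ := by
  have ho : IsOpen (Ioi (0 : ℝ) ×ˢ (univ : Set (En n))) := isOpen_Ioi.prod isOpen_univ
  have hFd : ContDiff ℝ 1 (dd (1, 0) F) := contDiff_dd (m := 1) (k := 2) hF le_rfl _
  have hsub : ContDiff ℝ 2 fun p : ℝ × En n => (p.1, x - p.2) := by fun_prop
  have hq : ContDiffOn ℝ 1 (fun p : ℝ × En n => W n p.1 p.2 * F (p.1, x - p.2))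
      (Ioi 0 ×ˢ univ) :=
    ((contDiffOn_W n).mul (hF.comp hsub).contDiffOn).of_le one_le_two
  have hK' : IsCompact ((Homeomorph.subLeft x) ⁻¹' K) :=
    (Homeomorph.subLeft x).isCompact_preimage.2 hK
  refine (hasDerivAt_integral_of_contDiffOn hq hK' (fun σ y hy => ?_) hτ).congr_deriv ?_
  · simp [hFK σ (x - y) hy]
  have hslice : ContDiff ℝ 2 fun y => F (τ, y) := hF.comp (contDiff_prodMk_right τ)
  have hsc : HasCompactSupport fun y => F (τ, y) :=
    HasCompactSupport.intro hK fun y hy => hFK τ y hy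
  have e : ∀ y, fderiv ℝ (fun p : ℝ × En n => W n p.1 p.2 * F (p.1, x - p.2)) (τ, y) (1, 0) =
      Wt n τ y * F (τ, x - y) + W n τ y * dd (1, 0) F (τ, x - y) := by
    intro y
    have h1 : HasFDerivAt (fun p : ℝ × En n => W n p.1 p.2 * F (p.1, x - p.2))
        (fderiv ℝ (fun p : ℝ × En n => W n p.1 p.2 * F (p.1, x - p.2)) (τ, y)) (τ, y) :=
      ((hq.differentiableOn one_ne_zero).differentiableAt
        (ho.mem_nhds (mk_mem_prod (mem_Ioi.2 hτ) (mem_univ y)))).hasFDerivAt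
    have h2 := h1.comp_hasDerivAt τ ((hasDerivAt_id τ).prodMk (hasDerivAt_const τ y))
    have h3 : HasDerivAt (fun σ => F (σ, x - y)) (dd (1, 0) F (τ, x - y)) τ :=
      (hF.differentiable two_ne_zero (τ, x - y)).hasFDerivAt.comp_hasDerivAt τ
        ((hasDerivAt_id τ).prodMk (hasDerivAt_const τ (x - y)))
    have h4 := (hasDerivAt_W hτ y).differentiableAt.hasDerivAt.mul h3
    exact h2.unique h4
  have hsup : ∀ {h : En n → ℝ}, HasCompactSupport h → HasCompactSupport fun y => h (x - y) :=
    fun hc => hc.comp_homeomorph (Homeomorph.subLeft x)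
  have hdc : HasCompactSupport fun y => dd (1, 0) F (τ, y) :=
    HasCompactSupport.intro hK fun y hy => by
      have h3 : HasDerivAt (fun σ => F (σ, y)) (dd (1, 0) F (τ, y)) τ :=
        (hF.differentiable two_ne_zero (τ, y)).hasFDerivAt.comp_hasDerivAt τ
          ((hasDerivAt_id τ).prodMk (hasDerivAt_const τ y))
      exact h3.unique ((hasDerivAt_const τ (0 : ℝ)).congr_of_eventuallyEq
          (Eventually.of_forall fun s => hFK s y hy))
  have hWc : Continuous (W n τ) := (contDiff_W hτ).continuous
  have hWt : Continuous (Wt n τ) := by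
    have : Wt n τ = fun y => W n τ y * (‖y‖ ^ 2 / (4 * τ ^ 2) - n / (2 * τ)) :=
      funext fun y => (hasDerivAt_W hτ y).deriv
    rw [this]
    fun_prop
  have hlap : Continuous (lap fun y => F (τ, y)) := by
    unfold lap
    exact continuous_finsetSum _ fun i _ =>
      (contDiff_dd (m := 0) (k := 1) (contDiff_pd hslice i) le_rfl _).continuous
  have hlapc : HasCompactSupport (lap fun y => F (τ, y)) := by
    refine HasCompactSupport.intro' (K := tsupport fun y => F (τ, y)) hsc (isClosed_tsupport _)
      fun y hy => Finset.sum_eq_zero fun i _ => ?_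
    refine image_eq_zero_of_notMem_tsupport fun hy' => hy ?_
    exact (tsupport_fderiv_apply_subset ℝ _).trans (tsupport_fderiv_apply_subset ℝ _) hy'
  have hFd' := hFd.continuous
  have hFc := hF.continuous
  simp_rw [e, mul_add]
  rw [integral_add, integral_add, integral_Wt_mul hτ hslice hsc x]
  · exact Continuous.integrable_of_hasCompactSupport (by fun_prop) (hsup hlapc).mul_left
  · exact Continuous.integrable_of_hasCompactSupport
      (hWc.mul (hFd'.comp (by fun_prop))) (hsup hdc).mul_left
  · exact Continuous.integrable_of_hasCompactSupport (by fun_prop) (hsup hsc).mul_left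
  · exact Continuous.integrable_of_hasCompactSupport
      (hWc.mul (hFd'.comp (by fun_prop))) (hsup hdc).mul_left

lemma hasCompactSupport_slice {n : ℕ} {f : ℝ × En n → ℝ} (hfc : HasCompactSupport f) (s : ℝ) :
    HasCompactSupport fun y => f (s, y) :=
  HasCompactSupport.intro (hfc.isCompact.image continuous_snd) fun y hy =>
    image_eq_zero_of_notMem_tsupport fun h => hy ⟨(s, y), h, rfl⟩

lemma pd_slice {n : ℕ} {f : ℝ × En n → ℝ} (hf : Differentiable ℝ f) (s : ℝ) (i : Fin n) :
    pd i (fun y => f (s, y)) = fun y => dd (0, EuclideanSpace.single i 1) f (s, y) := by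
  ext y
  have h1 : HasFDerivAt (fun y : En n => (s, y)) (ContinuousLinearMap.inr ℝ ℝ (En n)) y :=
    hasFDerivAt_prodMk_right s y
  have h2 := (hf (s, y)).hasFDerivAt.comp y h1
  rw [pd]
  erw [h2.fderiv]
  simp

lemma pd_pd_slice {n : ℕ} {f : ℝ × En n → ℝ} (hf : ContDiff ℝ 2 f) (s : ℝ) (i j : Fin n) :
    pd i (pd j (fun y => f (s, y))) = fun y =>
      dd (0, EuclideanSpace.single i 1) (dd (0, EuclideanSpace.single j 1) f) (s, y) := by
  rw [pd_slice (hf.differentiable two_ne_zero)]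
  exact pd_slice ((contDiff_dd (m := 1) (k := 2) hf le_rfl _).differentiable one_ne_zero) s i

/-- The Laplacian in the space variables of a function of space-time. -/
def spaceLap {n : ℕ} (f : ℝ × En n → ℝ) (z : ℝ × En n) : ℝ :=
  ∑ i : Fin n, dd (0, EuclideanSpace.single i 1) (dd (0, EuclideanSpace.single i 1) f) z

lemma lap_slice {n : ℕ} {f : ℝ × En n → ℝ} (hf : ContDiff ℝ 2 f) (s : ℝ) (y : En n) :
    lap (fun y => f (s, y)) y = spaceLap f (s, y) := by
  simp_rw [lap, pd_pd_slice hf, spaceLap]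

lemma continuous_dd_dd {G : Type*} [NormedAddCommGroup G] [NormedSpace ℝ G] {f : G → ℝ}
    (hf : ContDiff ℝ 2 f) (v w : G) : Continuous (dd v (dd w f)) :=
  (contDiff_dd (m := 0) (k := 1) (contDiff_dd (m := 1) (k := 2) hf le_rfl w) le_rfl v).continuous

lemma exists_abs_dd_dd_le {G : Type*} [NormedAddCommGroup G] [NormedSpace ℝ G] {f : G → ℝ}
    (hf : ContDiff ℝ 2 f) (hfc : HasCompactSupport f) (v w : G) :
    ∃ M, ∀ z, |dd v (dd w f) z| ≤ M :=
  exists_abs_le_of_hasCompactSupport (continuous_dd_dd hf v w)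
    (hasCompactSupport_dd (hasCompactSupport_dd hfc w) v)

lemma continuous_spaceLap {n : ℕ} {f : ℝ × En n → ℝ} (hf : ContDiff ℝ 2 f) :
    Continuous (spaceLap f) :=
  continuous_finsetSum _ fun _ _ => continuous_dd_dd hf _ _

lemma exists_abs_spaceLap_le {n : ℕ} {f : ℝ × En n → ℝ} (hf : ContDiff ℝ 2 f)
    (hfc : HasCompactSupport f) : ∃ M, ∀ z, |spaceLap f z| ≤ M := by
  choose M hM using fun i : Fin n => exists_abs_dd_dd_le hf hfc
    (0, EuclideanSpace.single i 1) (0, EuclideanSpace.single i 1)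
  exact ⟨∑ i, M i, fun z => (Finset.abs_sum_le_sum_abs _ _).trans
    (Finset.sum_le_sum fun i _ => hM i z)⟩

lemma integrable_W_mul {n : ℕ} {τ : ℝ} (hτ : 0 < τ) {h : En n → ℝ} (hh : Continuous h) {M : ℝ}
    (hM : ∀ y, |h y| ≤ M) : Integrable fun y => W n τ y * h y :=
  (integrable_W hτ).mul_bdd (c := M) hh.aestronglyMeasurable (Eventually.of_forall fun y => hM y)

lemma heatAvg_spaceLap {n : ℕ} {f : ℝ × En n → ℝ} (hf : ContDiff ℝ 2 f)
    (hfc : HasCompactSupport f) (x : En n) (s τ : ℝ) :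
    heatAvg n (spaceLap f) x s τ = ∑ i, heatAvg n
      (dd (0, EuclideanSpace.single i 1) (dd (0, EuclideanSpace.single i 1) f)) x s τ := by
  simp_rw [heatAvg, spaceLap, Finset.mul_sum]
  refine integral_finsetSum _ fun i _ => ?_
  obtain ⟨M, hM⟩ := exists_abs_dd_dd_le hf hfc
    (0, EuclideanSpace.single i 1) (0, EuclideanSpace.single i 1)
  exact integrable_W_mul one_pos ((continuous_dd_dd hf _ _).comp (by fun_prop)) fun y => hM _

lemma intervalIntegrable_heatAvg {n : ℕ} {f : ℝ × En n → ℝ} (hf : Continuous f) {M : ℝ}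
    (hM : ∀ z, |f z| ≤ M) (x : En n) (s a b : ℝ) :
    IntervalIntegrable (heatAvg n f x s) volume a b :=
  ((continuous_heatAvg hf hM x).comp (Continuous.prodMk_right s)).intervalIntegrable a b

lemma hasDerivAt_heatAvg {n : ℕ} {f : ℝ × En n → ℝ} (hf : ContDiff ℝ 2 f)
    (hfc : HasCompactSupport f) (x : En n) (t : ℝ) {τ : ℝ} (hτ : 0 < τ) :
    HasDerivAt (heatAvg n f x t)
      (heatAvg n (spaceLap f) x t τ - heatAvg n (dd (1, 0) f) x t τ) τ := by
  have hF : ContDiff ℝ 2 fun p : ℝ × En n => f (t - p.1, p.2) := hf.comp (by fun_prop)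
  have h := hasDerivAt_integral_W_mul hF (hfc.isCompact.image continuous_snd)
    (fun σ y hy => image_eq_zero_of_notMem_tsupport fun h => hy ⟨(t - σ, y), h, rfl⟩) x hτ
  have hdt : ∀ y, dd (1, 0) (fun p : ℝ × En n => f (t - p.1, p.2)) (τ, y) =
      -dd (1, 0) f (t - τ, y) := by
    intro y
    have h1 : HasDerivAt (fun σ => f (t - σ, y))
        (dd (1, 0) (fun p : ℝ × En n => f (t - p.1, p.2)) (τ, y)) τ :=
      (hF.differentiable two_ne_zero (τ, y)).hasFDerivAt.comp_hasDerivAt (f := fun σ => (σ, y)) τ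
        ((hasDerivAt_id τ).prodMk (hasDerivAt_const τ y))
    have h2 : HasDerivAt (fun σ => f (t - σ, y)) (fderiv ℝ f (t - τ, y) (-1, 0)) τ :=
      (hf.differentiable two_ne_zero (t - τ, y)).hasFDerivAt.comp_hasDerivAt τ
        (((hasDerivAt_id τ).const_sub t).prodMk (hasDerivAt_const τ y))
    rw [h1.unique h2, dd, ← map_neg]
    simp
  simp_rw [lap_slice hf, hdt] at h
  obtain ⟨M, hM⟩ := exists_abs_spaceLap_le hf hfc
  have hfd : Continuous (dd (1, 0) f) := (contDiff_dd (m := 1) (k := 2) hf le_rfl _).continuous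
  obtain ⟨M', hM'⟩ := exists_abs_le_of_hasCompactSupport hfd (hasCompactSupport_dd hfc (1, 0))
  have hfl := continuous_spaceLap hf
  refine (h.congr_of_eventuallyEq ?_).congr_deriv ?_
  · filter_upwards [lt_mem_nhds hτ] with σ hσ using (integral_W_mul_eq_heatAvg f x t hσ).symm
  · simp_rw [← sub_eq_add_neg, mul_sub]
    rw [integral_sub, integral_W_mul_eq_heatAvg _ x t hτ, integral_W_mul_eq_heatAvg _ x t hτ]
    · exact integrable_W_mul hτ (hfl.comp (by fun_prop)) fun y => hM _
    · exact integrable_W_mul hτ (hfd.comp (by fun_prop)) fun y => hM' _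

lemma heatAvg_self_eq {n : ℕ} {f : ℝ × En n → ℝ} (hf : ContDiff ℝ 2 f)
    (hfc : HasCompactSupport f) (x : En n) {t : ℝ} (ht : 0 < t) :
    heatAvg n f x t t = f (t, x) + (∫ τ in 0..t, heatAvg n (spaceLap f) x t τ) -
      ∫ τ in 0..t, heatAvg n (dd (1, 0) f) x t τ := by
  obtain ⟨M₀, hM₀⟩ := exists_abs_le_of_hasCompactSupport hf.continuous hfc
  obtain ⟨M, hM⟩ := exists_abs_spaceLap_le hf hfc
  have hfd : Continuous (dd (1, 0) f) := (contDiff_dd (m := 1) (k := 2) hf le_rfl _).continuous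
  obtain ⟨M', hM'⟩ := exists_abs_le_of_hasCompactSupport hfd (hasCompactSupport_dd hfc (1, 0))
  have hc : Continuous (heatAvg n f x t) :=
    (continuous_heatAvg hf.continuous hM₀ x).comp (Continuous.prodMk_right t)
  have i1 := intervalIntegrable_heatAvg (continuous_spaceLap hf) hM x t 0 t
  have i2 := intervalIntegrable_heatAvg hfd hM' x t 0 t
  have h := intervalIntegral.integral_eq_sub_of_hasDerivAt_of_le ht.le hc.continuousOn
    (fun τ hτ => hasDerivAt_heatAvg hf hfc x t hτ.1) (i1.sub i2)
  rw [intervalIntegral.integral_sub i1 i2, heatAvg_zero] at h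
  linarith

lemma hasDerivAt_vSol {n : ℕ} {f : ℝ × En n → ℝ} {g : En n → ℝ} (hf : ContDiff ℝ 2 f)
    (hfc : HasCompactSupport f) (hg : ContDiff ℝ 2 g) (hgc : HasCompactSupport g) (x : En n)
    {t : ℝ} (ht : 0 < t) :
    HasDerivAt (fun s => vSol n f g s x)
      ((∫ τ in 0..t, heatAvg n (spaceLap f) x t τ) + f (t, x) +
        ∫ y, W n t y * lap g (x - y)) t := by
  obtain ⟨M₀, hM₀⟩ := exists_abs_le_of_hasCompactSupport hf.continuous hfc
  have hfd : Continuous (dd (1, 0) f) := (contDiff_dd (m := 1) (k := 2) hf le_rfl _).continuous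
  obtain ⟨M', hM'⟩ := exists_abs_le_of_hasCompactSupport hfd (hasCompactSupport_dd hfc (1, 0))
  obtain ⟨L, hL, hL'⟩ := hasFDerivAt_integral_translate_apply (integrable_W_prod n t)
    (φ := fun p => p) aestronglyMeasurable_id (hf.of_le one_le_two) hfc (t, x)
  have h1 : HasDerivAt (fun s => ∫ τ in 0..t, heatAvg n f x s τ)
      (∫ τ in 0..t, heatAvg n (dd (1, 0) f) x t τ) t := by
    have := hL.comp_hasDerivAt t ((hasDerivAt_id t).prodMk (hasDerivAt_const t x))
    rw [hL', integral_prod_eq_heatAvg hfd hM' ht.le] at this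
    refine this.congr_of_eventuallyEq (Eventually.of_forall fun s => ?_)
    exact (integral_prod_eq_heatAvg hf.continuous hM₀ ht.le s x).symm
  have h2 := hasDerivAt_intervalIntegral_diag (continuous_heatAvg hf.continuous hM₀ x) t
  have h3 : HasDerivAt (fun s => ∫ y, W n s y * g (x - y)) (∫ y, W n t y * lap g (x - y)) t := by
    have := hasDerivAt_integral_W_mul (F := fun p => g p.2) (hg.comp contDiff_snd) hgc.isCompact
      (fun σ y hy => image_eq_zero_of_notMem_tsupport hy) x ht
    refine this.congr_deriv (integral_congr_ae (Eventually.of_forall fun y => ?_))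
    have hz : dd (1, 0) (fun p : ℝ × En n => g p.2) (t, x - y) = 0 := by
      have := ((hg.differentiable two_ne_zero (x - y)).hasFDerivAt.comp (t, x - y)
        (hasFDerivAt_snd (𝕜 := ℝ) (p := (t, x - y)))).fderiv
      rw [dd]
      erw [this]
      simp
    simp [hz]
  refine (((h1.add h2).add h3).congr_of_eventuallyEq ?_).congr_deriv ?_
  · filter_upwards [lt_mem_nhds ht] with s hs
    rw [vSol_eq f g hs.le, ← intervalIntegral.integral_add_adjacent_intervals
      (intervalIntegrable_heatAvg hf.continuous hM₀ x s 0 t)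
      (intervalIntegrable_heatAvg hf.continuous hM₀ x s t s)]
    rfl
  · rw [heatAvg_self_eq hf hfc x ht]
    ring

lemma pd_pd_vSol {n : ℕ} {f : ℝ × En n → ℝ} {g : En n → ℝ} (hf : ContDiff ℝ 2 f)
    (hfc : HasCompactSupport f) (hg : ContDiff ℝ 2 g) (hgc : HasCompactSupport g) (x : En n)
    {t : ℝ} (ht : 0 < t) (i j : Fin n) :
    pd i (pd j (vSol n f g t)) x = (∫ τ in 0..t, heatAvg n
      (dd (0, EuclideanSpace.single i 1) (dd (0, EuclideanSpace.single j 1) f)) x t τ) +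
        ∫ y, W n t y * pd i (pd j g) (x - y) := by
  rw [pd_vSol (hf.of_le one_le_two) hfc (hg.of_le one_le_two) hgc ht,
    pd_vSol (contDiff_dd (m := 1) (k := 2) hf le_rfl _) (hasCompactSupport_dd hfc _)
      (contDiff_pd hg j) (hasCompactSupport_pd hgc j) ht, vSol_eq _ _ ht.le]

lemma lap_vSol {n : ℕ} {f : ℝ × En n → ℝ} {g : En n → ℝ} (hf : ContDiff ℝ 2 f)
    (hfc : HasCompactSupport f) (hg : ContDiff ℝ 2 g) (hgc : HasCompactSupport g) (x : En n)
    {t : ℝ} (ht : 0 < t) :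
    lap (vSol n f g t) x = (∫ τ in 0..t, heatAvg n (spaceLap f) x t τ) +
      ∫ y, W n t y * lap g (x - y) := by
  simp_rw [lap, pd_pd_vSol hf hfc hg hgc x ht, heatAvg_spaceLap hf hfc, Finset.sum_add_distrib,
    Finset.mul_sum]
  rw [intervalIntegral.integral_finsetSum, integral_finsetSum]
  · intro i _
    obtain ⟨M, hM⟩ := exists_abs_dd_dd_le hg hgc
      (EuclideanSpace.single i 1) (EuclideanSpace.single i 1)
    exact integrable_W_mul ht ((continuous_dd_dd hg _ _).comp (by fun_prop)) fun y => hM _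
  · intro i _
    obtain ⟨M, hM⟩ := exists_abs_dd_dd_le hf hfc
      (0, EuclideanSpace.single i 1) (0, EuclideanSpace.single i 1)
    exact intervalIntegrable_heatAvg (continuous_dd_dd hf _ _) hM x t 0 t

lemma tendsto_setIntegral_Ioo_left {H ψ : ℝ → ℝ} (hψ : Continuous ψ)
    (h : ∀ τ, 0 < τ → H τ = ψ τ) {t : ℝ} (ht : 0 < t) :
    Tendsto (fun ε => ∫ τ in Ioo ε t, H τ) (𝓝[>] 0) (𝓝 (∫ τ in 0..t, ψ τ)) := by
  have hc : Continuous fun ε => ∫ τ in ε..t, ψ τ := by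
    simp_rw [fun ε => intervalIntegral.integral_symm (f := ψ) (μ := volume) t ε]
    exact (intervalIntegral.continuous_primitive (fun a b => hψ.intervalIntegrable a b) t).neg
  refine ((hc.tendsto 0).mono_left nhdsWithin_le_nhds).congr' ?_
  filter_upwards [Ioo_mem_nhdsGT ht] with ε hε
  rw [intervalIntegral.integral_of_le hε.2.le, integral_Ioc_eq_integral_Ioo]
  exact setIntegral_congr_fun measurableSet_Ioo fun τ hτ => (h τ (hε.1.trans hτ.1)).symm

lemma integral_mul_sub_comm {n : ℕ} (A B : En n → ℝ) (x : En n) :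
    ∫ y, A (x - y) * B y = ∫ y, A y * B (x - y) := by
  rw [← integral_sub_left_eq_self (fun y => A y * B (x - y)) volume x]
  simp

lemma tendsto_vSol_zero {n : ℕ} {f : ℝ × En n → ℝ} {g : En n → ℝ} {M M' : ℝ}
    (hM : ∀ z, |f z| ≤ M) (hg : Continuous g) (hM' : ∀ y, |g y| ≤ M') (x : En n) :
    Tendsto (fun t => vSol n f g t x) (𝓝[>] 0) (𝓝 (g x)) := by
  have h1 : Tendsto (fun t : ℝ => ∫ τ in 0..t, heatAvg n f x t τ) (𝓝[>] 0) (𝓝 0) := by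
    refine squeeze_zero_norm (a := fun t : ℝ => M * |t - 0|)
      (fun t => intervalIntegral.norm_integral_le_of_norm_le_const
        fun τ _ => abs_heatAvg_le hM x t τ) ?_
    have : Continuous fun t : ℝ => M * |t - 0| := by fun_prop
    have := this.tendsto 0
    simp only [sub_zero, abs_zero, mul_zero] at this ⊢
    exact this.mono_left nhdsWithin_le_nhds
  have hc := (continuous_heatAvg (f := fun z => g z.2) (hg.comp continuous_snd)
    (fun z => hM' z.2) x).comp (Continuous.prodMk_right (0 : ℝ))
  have h2 := (hc.tendsto 0).mono_left (nhdsWithin_le_nhds (s := Ioi 0))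
  simp only [Function.comp_apply, heatAvg_zero] at h2
  have h3 := h1.add h2
  rw [zero_add] at h3
  refine h3.congr' ?_
  filter_upwards [self_mem_nhdsWithin] with t ht
  rw [vSol_eq f g (le_of_lt ht)]
  congr 1
  exact (integral_W_mul_eq_heatAvg (fun z => g z.2) x 0 ht).symm

/-- classical solvability of the Cauchy problem for the heat equation.
For `g` bounded `C²` compactly supported on `ℝⁿ` and `f` bounded `C²` compactly supported
(in the time-space variables), the integrals defining `v` converge absolutely for every
`t > 0`, `v` solves `∂_t v = Δv + f` for `t > 0` with initial datum `g` (attained as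
`t → 0⁺`), and the pointwise principal-value formulas for `∂_{x_i x_j} v` and `∂_t v` hold. -/
theorem heat_cauchy_classical_solvability (n : ℕ) (hn : 1 ≤ n)
    (g : En n → ℝ) (hgb : ∃ M, ∀ x, |g x| ≤ M) (hg2 : ContDiff ℝ 2 g)
    (hgc : HasCompactSupport g)
    (f : ℝ × En n → ℝ) (hfb : ∃ M, ∀ z, |f z| ≤ M) (hf2 : ContDiff ℝ 2 f)
    (hfc : HasCompactSupport f) :
    (∀ (t : ℝ), 0 < t → ∀ x : En n,
      IntegrableOn (fun p : ℝ × En n => W n p.1 p.2 * f (t - p.1, x - p.2))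
        (Set.Ioo (0 : ℝ) t ×ˢ (Set.univ : Set (En n))) ∧
      Integrable (fun y : En n => W n t (x - y) * g y)) ∧
    (∀ (t : ℝ), 0 < t → ∀ x : En n,
      HasDerivAt (fun s : ℝ => vSol n f g s x)
        (lap (fun x' : En n => vSol n f g t x') x + f (t, x)) t) ∧
    (∀ x : En n, Tendsto (fun t : ℝ => vSol n f g t x) (𝓝[>] 0) (𝓝 (g x))) ∧
    (∀ (t : ℝ), 0 < t → ∀ (x : En n) (i j : Fin n),
      Tendsto
        (fun ε : ℝ => ∫ τ in Set.Ioo ε t, ∫ y : En n, Wij n i j τ (x - y) * f (t - τ, y))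
        (𝓝[>] 0)
        (𝓝 (pd i (pd j (fun x' : En n => vSol n f g t x')) x
            - ∫ y : En n, Wij n i j t y * g (x - y)))) ∧
    (∀ (t : ℝ), 0 < t → ∀ x : En n,
      Tendsto
        (fun ε : ℝ => ∫ τ in Set.Ioo ε t, ∫ y : En n, Wt n τ (x - y) * f (t - τ, y))
        (𝓝[>] 0)
        (𝓝 (deriv (fun s : ℝ => vSol n f g s x) t
            - (∫ y : En n, Wt n t y * g (x - y)) - f (t, x)))) := by
  obtain ⟨Mg, hMg⟩ := hgb
  obtain ⟨Mf, hMf⟩ := hfb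
  refine ⟨fun t ht x => ⟨integrableOn_W_mul hf2.continuous hMf t t x, ?_⟩, fun t ht x => ?_,
    tendsto_vSol_zero hMf hg2.continuous hMg, fun t ht x i j => ?_, fun t ht x => ?_⟩
  · refine ((integrable_W_mul ht (hg2.continuous.comp (by fun_prop : Continuous fun y => x - y))
      fun y => hMg _).comp_sub_left x).congr (Eventually.of_forall fun y => ?_)
    simp
  · rw [lap_vSol hf2 hfc hg2 hgc x ht]
    exact (hasDerivAt_vSol hf2 hfc hg2 hgc x ht).congr_deriv (by ring)
  · obtain ⟨M, hM⟩ := exists_abs_dd_dd_le hf2 hfc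
      (0, EuclideanSpace.single i 1) (0, EuclideanSpace.single j 1)
    rw [pd_pd_vSol hf2 hfc hg2 hgc x ht, integral_Wij_mul ht hg2 hgc x i j, add_sub_cancel_right]
    refine tendsto_setIntegral_Ioo_left ((continuous_heatAvg (continuous_dd_dd hf2 _ _) hM x).comp
      (Continuous.prodMk_right t)) (fun τ hτ => ?_) ht
    rw [integral_mul_sub_comm (Wij n i j τ) (fun y => f (t - τ, y)),
      integral_Wij_mul hτ (h := fun y => f (t - τ, y)) (hf2.comp (contDiff_prodMk_right _))
        (hasCompactSupport_slice hfc _),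
      pd_pd_slice hf2]
    exact integral_W_mul_eq_heatAvg _ x t hτ
  · obtain ⟨M, hM⟩ := exists_abs_spaceLap_le hf2 hfc
    rw [(hasDerivAt_vSol hf2 hfc hg2 hgc x ht).deriv, integral_Wt_mul ht hg2 hgc x,
      add_sub_cancel_right, add_sub_cancel_right]
    refine tendsto_setIntegral_Ioo_left ((continuous_heatAvg (continuous_spaceLap hf2) hM x).comp
      (Continuous.prodMk_right t)) (fun τ hτ => ?_) ht
    rw [integral_mul_sub_comm (Wt n τ) (fun y => f (t - τ, y)),
      integral_Wt_mul hτ (h := fun y => f (t - τ, y)) (hf2.comp (contDiff_prodMk_right _))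
        (hasCompactSupport_slice hfc _)]
    simp_rw [lap_slice hf2]
    exact integral_W_mul_eq_heatAvg _ x t hτ
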